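/- Let W be a 2-dimensional Coxeter group. Let f ∈ W with T(f) = {s, t} for distinct s, t ∈ S (so that m_st < ∞), let h = Π(f), and let R = f⟨s,t⟩ be the {s,t}-residue containing f and h. Let g ∈ R, let m = ℓ(h⁻¹g) be the distance in the Cayley graph between g and h, and suppose T(g) = {s, r} for some r ∈ S with r ∉ {s, t}. Then m ≤ 3. -/

import Mathlib

namespace CoxeterPaper

open CoxeterSystem

attribute [local instance] Classical.propDecidable

variable {B : Type} [DecidableEq B] [Fintype B]
variable {W : Type} [Group W] {M : CoxeterMatrix B}

/-- The right descent set `T(g) = {s ∈ S : ℓ(gs) < ℓ(g)}`, as a set of indices. -/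
def descentSet (cs : CoxeterSystem M W) (g : W) : Set B :=
  {i | cs.IsRightDescent g i}

/-- The subgroup `⟨T(g)⟩` generated by the right descent set of `g`. -/
def descSubgroup (cs : CoxeterSystem M W) (g : W) : Subgroup W :=
  Subgroup.closure (cs.simple '' descentSet cs g)

/-- `w(g)`: the longest element of `⟨T(g)⟩` (defined via choice; for `g ≠ 1` the
subgroup `⟨T(g)⟩` is finite and has a unique longest element). -/
noncomputable def wg (cs : CoxeterSystem M W) (g : W) : W :=
  if h : ∃ w₀ ∈ descSubgroup cs g, ∀ u ∈ descSubgroup cs g, cs.length u ≤ cs.length w₀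
  then h.choose else 1

/-- `Π(g) = g · w(g)`. -/
noncomputable def PiMap (cs : CoxeterSystem M W) (g : W) : W := g * wg cs g

/-- The standard language `𝓛 ⊆ S*`: the empty word is in `𝓛` (and it is the only word of `𝓛`
representing the identity); a word `v` of length `n` representing `g ≠ 1` is in `𝓛` iff,
setting `k = ℓ(w(g))`, the prefix `v(n-k)` is in `𝓛` and `v(n-k+1, n)` represents `w(g)`. -/
inductive StdLang (cs : CoxeterSystem M W) : List B → Prop
  | nil : StdLang cs []
  | step (v : List B) (hne : cs.wordProd v ≠ 1)
      (hpre : StdLang cs (v.take (v.length - cs.length (wg cs (cs.wordProd v)))))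
      (hsuf : cs.wordProd (v.drop (v.length - cs.length (wg cs (cs.wordProd v))))
        = wg cs (cs.wordProd v)) : StdLang cs v

/-- A Coxeter group is 2-dimensional if every triple of distinct generators
generates an infinite subgroup. -/
def TwoDimensional (cs : CoxeterSystem M W) : Prop :=
  ∀ i j k : B, i ≠ j → i ≠ k → j ≠ k →
    Infinite (Subgroup.closure {cs.simple i, cs.simple j, cs.simple k} : Subgroup W)

/-- The wall of the reflection `ρ` separates `g` and `h`. -/
def Separates (cs : CoxeterSystem M W) (ρ g h : W) : Prop :=
  Xor' (cs.length (ρ * g) < cs.length g) (cs.length (ρ * h) < cs.length h)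

/-- `h` is adjacent to the wall of the reflection `ρ`. -/
def AdjacentWall (cs : CoxeterSystem M W) (ρ h : W) : Prop :=
  ∃ i : B, ρ = h * cs.simple i * h⁻¹

/-- The wall of `ρ'` separates `g` from the wall of `ρ`. -/
def SeparatesFromWall (cs : CoxeterSystem M W) (ρ' g ρ : W) : Prop :=
  ∀ h : W, AdjacentWall cs ρ h → Separates cs ρ' g h

/-- `𝓦(g)`: the set of walls (identified with their reflections) separating `g` from the
identity and not separated from `g` by any other wall. -/
def WallsNear (cs : CoxeterSystem M W) (g : W) : Set W :=
  {ρ | cs.IsReflection ρ ∧ cs.length (ρ * g) < cs.length g ∧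
    ∀ ρ' : W, cs.IsReflection ρ' → ρ' ≠ ρ → ¬ SeparatesFromWall cs ρ' g ρ}


set_option linter.unusedSectionVars false

/-! ### The reflection cocycle -/

/-- The self-map `(t, ε) ↦ (s_i t s_i, ε + [t = s_i])` on `W × ℤ/2`. -/
noncomputable def reflStep (cs : CoxeterSystem M W) (i : B) : Function.End (W × ZMod 2) :=
  fun p ↦ (cs.simple i * p.1 * cs.simple i, p.2 + if p.1 = cs.simple i then 1 else 0)

theorem reflStep_mul_pow_apply (cs : CoxeterSystem M W) (i j : B) (n : ℕ) (t : W) (ε : ZMod 2) :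
    ((reflStep cs i * reflStep cs j) ^ n) (t, ε) =
      ((cs.simple i * cs.simple j) ^ n * t * ((cs.simple i * cs.simple j) ^ n)⁻¹,
        ε + ∑ l ∈ Finset.range (2 * n),
          if t = ((cs.simple i * cs.simple j) ^ l)⁻¹ * cs.simple j then 1 else 0) := by
  set τ := cs.simple i * cs.simple j with hτ
  have hτi : τ⁻¹ = cs.simple j * cs.simple i := by simp [hτ]
  have hconj : ∀ n : ℕ, cs.simple j * τ ^ n = (τ ^ n)⁻¹ * cs.simple j := by
    intro n
    have : SemiconjBy (cs.simple j) τ τ⁻¹ := by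
      simp [SemiconjBy, hτ, mul_assoc]
    simpa [SemiconjBy] using this.pow_right n
  induction n with
  | zero => simp; rfl
  | succ n ih =>
    rw [pow_succ']
    change (reflStep cs i * reflStep cs j) (((reflStep cs i * reflStep cs j) ^ n) (t, ε)) = _
    rw [ih]
    change reflStep cs i (reflStep cs j _) = _
    simp only [reflStep, Prod.mk.injEq]
    refine ⟨by rw [pow_succ' τ n, mul_inv_rev, hτi, hτ]; simp only [mul_assoc], ?_⟩
    rw [show 2 * (n + 1) = 2 * n + 1 + 1 by ring, Finset.sum_range_succ, Finset.sum_range_succ,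
      ← add_assoc, ← add_assoc]
    have e1 : τ ^ n * t * (τ ^ n)⁻¹ = cs.simple j ↔ t = (τ ^ (2 * n))⁻¹ * cs.simple j := by
      rw [mul_inv_eq_iff_eq_mul, ← eq_inv_mul_iff_mul_eq, hconj, two_mul, pow_add, mul_inv_rev,
        mul_assoc]
    have e2 : cs.simple j * (τ ^ n * t * (τ ^ n)⁻¹) * cs.simple j = cs.simple i ↔
        t = (τ ^ (2 * n + 1))⁻¹ * cs.simple j := by
      rw [show cs.simple j * (τ ^ n * t * (τ ^ n)⁻¹) * cs.simple j = cs.simple i ↔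
          τ ^ n * t * (τ ^ n)⁻¹ = τ⁻¹ * cs.simple j by
        rw [hτi, ← eq_mul_inv_iff_mul_eq, inv_simple, ← eq_inv_mul_iff_mul_eq, inv_simple]
        simp only [mul_assoc]]
      rw [mul_inv_eq_iff_eq_mul, ← eq_inv_mul_iff_mul_eq, mul_assoc, hconj,
        show 2 * n + 1 = n + 1 + n by ring, pow_add, mul_inv_rev (τ ^ (n + 1)),
        pow_succ, mul_inv_rev (τ ^ n) τ]
      simp only [mul_assoc]
    simp only [e1, e2]

theorem reflStep_isLiftable (cs : CoxeterSystem M W) : M.IsLiftable (reflStep cs) := by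
  intro i j
  funext ⟨t, ε⟩
  rw [reflStep_mul_pow_apply, two_mul, Finset.sum_range_add]
  simp only [pow_add, cs.simple_mul_simple_pow, one_mul, inv_one, mul_one, ← two_mul]
  rw [show (2 : ZMod 2) = 0 from rfl, zero_mul, add_zero]
  rfl

/-- The reflection cocycle: for a reflection `t`, `reflCocycle cs w t = 1` exactly when `t` is a
right inversion of `w`. -/
noncomputable def reflCocycle (cs : CoxeterSystem M W) (w t : W) : ZMod 2 :=
  (cs.lift ⟨reflStep cs, reflStep_isLiftable cs⟩ w (t, 0)).2

theorem lift_reflStep_apply (cs : CoxeterSystem M W) (w t : W) (ε : ZMod 2) :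
    cs.lift ⟨reflStep cs, reflStep_isLiftable cs⟩ w (t, ε) =
      (w * t * w⁻¹, ε + reflCocycle cs w t) := by
  unfold reflCocycle
  induction w using cs.simple_induction_left generalizing t ε with
  | one =>
    rw [map_one]
    change (t, ε) = (_, ε + 0)
    simp
  | mul_simple_left w i ih =>
    rw [map_mul, lift_apply_simple]
    change reflStep cs i _ = (_, ε + (reflStep cs i _).2)
    rw [ih, ih t 0]
    simp [reflStep, mul_assoc, add_assoc]

theorem reflCocycle_mul (cs : CoxeterSystem M W) (x y t : W) :
    reflCocycle cs (x * y) t = reflCocycle cs y t + reflCocycle cs x (y * t * y⁻¹) := by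
  conv_lhs => unfold reflCocycle
  rw [map_mul]
  change (cs.lift ⟨reflStep cs, reflStep_isLiftable cs⟩ x
    (cs.lift ⟨reflStep cs, reflStep_isLiftable cs⟩ y (t, 0))).2 = _
  rw [lift_reflStep_apply, lift_reflStep_apply, zero_add]

@[simp]
theorem reflCocycle_one (cs : CoxeterSystem M W) (t : W) : reflCocycle cs 1 t = 0 := by
  simp [reflCocycle]; rfl

theorem reflCocycle_simple (cs : CoxeterSystem M W) (i : B) (t : W) :
    reflCocycle cs (cs.simple i) t = if t = cs.simple i then 1 else 0 := by
  rw [reflCocycle, lift_apply_simple]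
  simp [reflStep]

theorem mem_rightInvSeq_of_reflCocycle_ne_zero (cs : CoxeterSystem M W) (ω : List B) {t : W}
    (h : reflCocycle cs (cs.wordProd ω) t ≠ 0) : t ∈ cs.rightInvSeq ω := by
  induction ω with
  | nil => simp at h
  | cons i ω ih =>
    rw [wordProd_cons, reflCocycle_mul, reflCocycle_simple] at h
    rw [rightInvSeq, List.mem_cons]
    by_cases ht : cs.wordProd ω * t * (cs.wordProd ω)⁻¹ = cs.simple i
    · left
      rw [← ht]
      group
    · exact Or.inr (ih (by simpa [ht] using h))

theorem length_mul_lt_of_reflCocycle_ne_zero (cs : CoxeterSystem M W) {w t : W}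
    (h : reflCocycle cs w t ≠ 0) : cs.length (w * t) < cs.length w := by
  obtain ⟨ω, hω, rfl⟩ := cs.exists_isReduced w
  exact (cs.isRightInversion_of_mem_rightInvSeq hω
    (mem_rightInvSeq_of_reflCocycle_ne_zero cs ω h)).2

theorem isRightDescent_iff_reflCocycle (cs : CoxeterSystem M W) (w : W) (i : B) :
    cs.IsRightDescent w i ↔ reflCocycle cs w (cs.simple i) = 1 := by
  have key : ∀ v, reflCocycle cs v (cs.simple i) = 1 → cs.IsRightDescent v i := fun v hv ↦
    length_mul_lt_of_reflCocycle_ne_zero cs (by rw [hv]; exact one_ne_zero)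
  refine ⟨fun h ↦ ?_, key w⟩
  by_contra hne
  have h0 : reflCocycle cs w (cs.simple i) = 0 := by
    generalize reflCocycle cs w (cs.simple i) = z at hne
    revert z
    decide
  refine (cs.isRightDescent_iff_not_isRightDescent_mul.1 h) (key _ ?_)
  rw [reflCocycle_mul, reflCocycle_simple]
  simp [h0]

/-! ### Alternating products of two involutions -/

/-- The alternating product with `n` factors among `a` and `b`, the last factor being `a`. -/
def altProd {G : Type*} [Monoid G] (a b : G) : ℕ → G
  | 0 => 1
  | n + 1 => altProd b a n * a

theorem altProd_succ_mul {G : Type*} [Group G] {a b : G} (ha : a * a = 1) (n : ℕ) :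
    altProd a b (n + 1) * a = altProd b a n := by
  rw [altProd, mul_assoc, ha, mul_one]

theorem altProd_mem_closure {G : Type*} [Group G] (a b : G) (n : ℕ) :
    altProd a b n ∈ Subgroup.closure {a, b} := by
  induction n generalizing a b with
  | zero => exact one_mem _
  | succ n ih =>
    refine mul_mem ?_ (Subgroup.subset_closure (by simp))
    rw [Set.pair_comm]
    exact ih b a

theorem altProd_eq_swap_mul {G : Type*} [Group G] (a b : G) (ha : a * a = 1) (hb : b * b = 1)
    (n : ℕ) : altProd a b n = altProd b a n * (b * a) ^ n := by
  induction n generalizing a b with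
  | zero => simp [altProd]
  | succ n ih =>
    have h1 : (a * b) ^ n * a = a * (b * a) ^ n :=
      ((show SemiconjBy a (b * a) (a * b) from (mul_assoc a b a).symm).pow_right n).symm
    rw [altProd, altProd, ih b a hb ha, pow_succ', mul_assoc, h1, mul_assoc, mul_assoc b a,
      ← mul_assoc b b, hb, one_mul]

theorem altProd_comm {G : Type*} [Group G] {a b : G} (ha : a * a = 1) (hb : b * b = 1)
    {n : ℕ} (h : (a * b) ^ n = 1) : altProd a b n = altProd b a n := by
  rw [altProd_eq_swap_mul b a hb ha, h, mul_one]

theorem orderOf_mul_comm {G : Type*} [Group G] {a b : G} (ha : a * a = 1) (hb : b * b = 1) :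
    orderOf (b * a) = orderOf (a * b) := by
  rw [← orderOf_inv, mul_inv_rev, inv_eq_of_mul_eq_one_right ha, inv_eq_of_mul_eq_one_right hb]

theorem mul_comm_of_orderOf_eq_two {G : Type*} [Group G] {a b : G} (ha : a * a = 1)
    (hb : b * b = 1) (h : orderOf (a * b) = 2) : a * b = b * a := by
  have := altProd_comm ha hb (h ▸ pow_orderOf_eq_one _)
  simpa only [altProd, one_mul] using this.symm

/-- Normal form in a dihedral group. -/
theorem exists_eq_altProd_of_mem_closure {G : Type*} [Group G] {a b : G} (ha : a * a = 1)
    (hb : b * b = 1) {u : G} (hu : u ∈ Subgroup.closure {a, b}) :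
    ∃ n, (orderOf (a * b) = 0 ∨ n ≤ orderOf (a * b)) ∧ (u = altProd a b n ∨ u = altProd b a n) := by
  have step : ∀ c d : G, c * c = 1 → d * d = 1 → orderOf (c * d) = orderOf (a * b) → ∀ u,
      (∃ n, (orderOf (a * b) = 0 ∨ n ≤ orderOf (a * b)) ∧
        (u = altProd c d n ∨ u = altProd d c n)) →
      ∃ n, (orderOf (a * b) = 0 ∨ n ≤ orderOf (a * b)) ∧
        (u * c = altProd c d n ∨ u * c = altProd d c n) := by
    rintro c d hc hd ho u ⟨n, hn, h⟩
    have aux : ∀ n, (orderOf (a * b) = 0 ∨ n + 1 ≤ orderOf (a * b)) → u = altProd c d (n + 1) →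
        ∃ n, (orderOf (a * b) = 0 ∨ n ≤ orderOf (a * b)) ∧
          (u * c = altProd c d n ∨ u * c = altProd d c n) := by
      rintro n hn rfl
      exact ⟨n, by omega, .inr (altProd_succ_mul hc n)⟩
    by_cases hlt : orderOf (a * b) = 0 ∨ n + 1 ≤ orderOf (a * b)
    · rcases h with h | h
      · rcases n with _ | n
        · exact ⟨1, hlt, .inl (by simp [h, altProd])⟩
        · exact aux n hn h
      · exact ⟨n + 1, hlt, .inl (by rw [h, altProd])⟩
    · obtain ⟨k, rfl⟩ : ∃ k, n = k + 1 := Nat.exists_eq_succ_of_ne_zero (by omega)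
      have hk : k + 1 = orderOf (c * d) := by omega
      have hcomm := altProd_comm hc hd (n := k + 1) (by rw [hk, pow_orderOf_eq_one])
      exact aux k hn (by rcases h with h | h <;> rw [h, hcomm])
  have stepa := step a b ha hb rfl
  have stepb : ∀ u, _ → _ := step b a hb ha (orderOf_mul_comm ha hb)
  simp only [or_comm (a := _ = altProd b a _)] at stepb
  have ha' : a⁻¹ = a := inv_eq_of_mul_eq_one_right ha
  have hb' : b⁻¹ = b := inv_eq_of_mul_eq_one_right hb
  induction hu using Subgroup.closure_induction_right with
  | one => exact ⟨0, by simp, .inl rfl⟩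
  | mul_right x hx y hy ih =>
    rcases hy with rfl | rfl
    · exact stepa _ ih
    · exact stepb _ ih
  | mul_inv_cancel x hx y hy ih =>
    rcases hy with rfl | rfl
    · rw [ha']
      exact stepa _ ih
    · rw [hb']
      exact stepb _ ih

/-! ### Descents along a dihedral residue -/

theorem reflCocycle_altProd (cs : CoxeterSystem M W) (c d : B) (n : ℕ) (k : ℤ) :
    reflCocycle cs (altProd (cs.simple c) (cs.simple d) n)
        ((cs.simple c * cs.simple d) ^ k * cs.simple c) =
      ∑ j ∈ Finset.range n, if (orderOf (cs.simple c * cs.simple d) : ℤ) ∣ k - j then 1 else 0 := by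
  induction n generalizing c d k with
  | zero => simp [altProd]
  | succ n ih =>
    have hc := cs.simple_mul_simple_self c
    have hd := cs.simple_mul_simple_self d
    have hconj : cs.simple c * ((cs.simple c * cs.simple d) ^ k * cs.simple c) * (cs.simple c)⁻¹ =
        (cs.simple d * cs.simple c) ^ (k - 1) * cs.simple d := by
      have h1 : cs.simple d * (cs.simple c * cs.simple d) ^ (k - 1) =
          (cs.simple d * cs.simple c) ^ (k - 1) * cs.simple d :=
        (show SemiconjBy (cs.simple d) (cs.simple c * cs.simple d) (cs.simple d * cs.simple c) from
          (mul_assoc _ _ _).symm).zpow_right (k - 1)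
      have h2 : (cs.simple c * cs.simple d) ^ k =
          cs.simple c * cs.simple d * (cs.simple c * cs.simple d) ^ (k - 1) := by
        rw [← zpow_one_add, add_sub_cancel]
      rw [← h1, ← mul_assoc, mul_inv_cancel_right, h2, mul_assoc,
        cs.simple_mul_simple_cancel_left]
    rw [altProd, reflCocycle_mul, reflCocycle_simple, hconj, ih, orderOf_mul_comm hc hd,
      Finset.sum_range_succ', add_comm]
    congr 1
    · refine Finset.sum_congr rfl fun j _ ↦ ?_
      rw [show k - 1 - (j : ℤ) = k - ((j + 1 : ℕ) : ℤ) by push_cast; ring]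
    · simp [orderOf_dvd_iff_zpow_eq_one]

theorem reflCocycle_altProd_last (cs : CoxeterSystem M W) (c d : B) {n : ℕ} (hn : n ≠ 0)
    (hle : orderOf (cs.simple c * cs.simple d) = 0 ∨ n ≤ orderOf (cs.simple c * cs.simple d)) :
    reflCocycle cs (altProd (cs.simple c) (cs.simple d) n) (cs.simple c) = 1 := by
  have := reflCocycle_altProd cs c d n 0
  rw [zpow_zero, one_mul] at this
  rw [this, Finset.sum_eq_single_of_mem 0 (Finset.mem_range.2 (by omega))]
  · simp
  · intro j hj hj0
    rw [Finset.mem_range] at hj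
    refine if_neg fun hdvd ↦ ?_
    rw [zero_sub, dvd_neg, Int.natCast_dvd_natCast] at hdvd
    rcases hle with h | h
    · rw [h, zero_dvd_iff] at hdvd
      exact hj0 hdvd
    · have := Nat.le_of_dvd (by omega) hdvd
      omega

theorem reflCocycle_altProd_other (cs : CoxeterSystem M W) (c d : B) {n : ℕ}
    (hlt : orderOf (cs.simple c * cs.simple d) = 0 ∨ n < orderOf (cs.simple c * cs.simple d)) :
    reflCocycle cs (altProd (cs.simple c) (cs.simple d) n) (cs.simple d) = 0 := by
  have := reflCocycle_altProd cs c d n (-1)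
  rw [zpow_neg_one, mul_inv_rev, mul_assoc, inv_mul_cancel, mul_one, inv_simple] at this
  rw [this]
  refine Finset.sum_eq_zero fun j hj ↦ if_neg fun hdvd ↦ ?_
  rw [Finset.mem_range] at hj
  rw [show (-1 - (j : ℤ)) = -((j + 1 : ℕ) : ℤ) by push_cast; ring, dvd_neg,
    Int.natCast_dvd_natCast] at hdvd
  rcases hlt with h | h
  · rw [h, zero_dvd_iff] at hdvd
    omega
  · have := Nat.le_of_dvd (by omega) hdvd
    omega

/-- `y` is not shortened by any reflection of the dihedral group `⟨s_c, s_d⟩`. -/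
def IsResidueMin (cs : CoxeterSystem M W) (c d : B) (y : W) : Prop :=
  ∀ t ∈ Subgroup.closure {cs.simple c, cs.simple d}, reflCocycle cs y t = 0

theorem exists_isResidueMin (cs : CoxeterSystem M W) (c d : B) (x : W) :
    ∃ y, IsResidueMin cs c d y ∧ y⁻¹ * x ∈ Subgroup.closure {cs.simple c, cs.simple d} := by
  set H := Subgroup.closure {cs.simple c, cs.simple d}
  obtain ⟨y, hy, hmin⟩ := (InvImage.wf cs.length wellFounded_lt).has_min {y | y⁻¹ * x ∈ H}
    ⟨x, by simp⟩
  refine ⟨y, fun t ht ↦ ?_, hy⟩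
  by_contra hne
  refine hmin (y * t) ?_ (length_mul_lt_of_reflCocycle_ne_zero cs hne)
  rw [Set.mem_ofPred_eq, mul_inv_rev, mul_assoc]
  exact mul_mem (inv_mem ht) hy

theorem IsResidueMin.isRightDescent_iff {cs : CoxeterSystem M W} {c d : B} {y u : W}
    (hy : IsResidueMin cs c d y) (hu : u ∈ Subgroup.closure {cs.simple c, cs.simple d}) {e : B}
    (he : e = c ∨ e = d) :
    cs.IsRightDescent (y * u) e ↔ reflCocycle cs u (cs.simple e) = 1 := by
  have hmem : cs.simple e ∈ Subgroup.closure {cs.simple c, cs.simple d} :=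
    Subgroup.subset_closure (by rcases he with rfl | rfl <;> simp)
  rw [isRightDescent_iff_reflCocycle, reflCocycle_mul, hy _ (mul_mem (mul_mem hu hmem) (inv_mem hu)),
    add_zero]

/-- `c, d, c, …` (with `n` letters) can be stripped one after the other from the right of `x`,
shortening it each time. -/
def DescentChain (cs : CoxeterSystem M W) : B → B → ℕ → W → Prop
  | _, _, 0, _ => True
  | c, d, n + 1, x => cs.IsRightDescent x c ∧ DescentChain cs d c n (x * cs.simple c)

theorem DescentChain.mono {cs : CoxeterSystem M W} {c d : B} {n m : ℕ} {x : W}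
    (h : DescentChain cs c d n x) (hm : m ≤ n) : DescentChain cs c d m x := by
  induction m generalizing c d n x with
  | zero => trivial
  | succ m ih =>
    obtain ⟨n, rfl⟩ : ∃ k, n = k + 1 := Nat.exists_eq_succ_of_ne_zero (by omega)
    exact ⟨h.1, ih h.2 (by omega)⟩

theorem DescentChain.le_length {cs : CoxeterSystem M W} {c d : B} {n : ℕ} {x : W}
    (h : DescentChain cs c d n x) : n ≤ cs.length x := by
  induction n generalizing c d x with
  | zero => omega
  | succ n ih =>
    have := cs.isRightDescent_iff.1 h.1
    have := ih h.2
    omega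

theorem IsResidueMin.descentChain {cs : CoxeterSystem M W} {c d : B} {y : W}
    (hy : IsResidueMin cs c d y) {n : ℕ}
    (hn : orderOf (cs.simple c * cs.simple d) = 0 ∨ n ≤ orderOf (cs.simple c * cs.simple d)) :
    DescentChain cs c d n (y * altProd (cs.simple c) (cs.simple d) n) := by
  induction n generalizing c d with
  | zero => trivial
  | succ n ih =>
    refine ⟨(hy.isRightDescent_iff (altProd_mem_closure _ _ _) (.inl rfl)).2
      (reflCocycle_altProd_last cs c d (by omega) hn), ?_⟩
    rw [mul_assoc, altProd_succ_mul (cs.simple_mul_simple_self c)]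
    refine ih (c := d) (d := c) (by rwa [IsResidueMin, Set.pair_comm]) ?_
    rw [orderOf_mul_comm (cs.simple_mul_simple_self c) (cs.simple_mul_simple_self d)]
    omega

/-- If both letters of a dihedral subgroup are descents of `x`, the dihedral subgroup is finite
and `x` ends with its longest element. -/
theorem exists_eq_mul_altProd (cs : CoxeterSystem M W) {c d : B} {x : W}
    (hc : cs.IsRightDescent x c) (hd : cs.IsRightDescent x d) :
    orderOf (cs.simple c * cs.simple d) ≠ 0 ∧ ∃ y, IsResidueMin cs c d y ∧
      x = y * altProd (cs.simple c) (cs.simple d) (orderOf (cs.simple c * cs.simple d)) := by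
  have hcc := cs.simple_mul_simple_self c
  have hdd := cs.simple_mul_simple_self d
  obtain ⟨y, hy, hu⟩ := exists_isResidueMin cs c d x
  set u := y⁻¹ * x with hux
  have hx : x = y * u := by rw [hux, mul_inv_cancel_left]
  rw [hx, hy.isRightDescent_iff hu (.inl rfl)] at hc
  rw [hx, hy.isRightDescent_iff hu (.inr rfl)] at hd
  obtain ⟨n, hn, h⟩ := exists_eq_altProd_of_mem_closure hcc hdd hu
  have hfull : ¬ (orderOf (cs.simple c * cs.simple d) = 0 ∨
      n < orderOf (cs.simple c * cs.simple d)) := by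
    intro hlt
    rcases h with h | h
    · rw [h, reflCocycle_altProd_other cs c d hlt] at hd
      exact zero_ne_one hd
    · rw [h, reflCocycle_altProd_other cs d c (by rwa [orderOf_mul_comm hcc hdd])] at hc
      exact zero_ne_one hc
  have hn : n = orderOf (cs.simple c * cs.simple d) := by omega
  refine ⟨by omega, y, hy, ?_⟩
  rw [hx]
  congr 1
  rcases h with h | h
  · rw [h, hn]
  · rw [h, hn, altProd_comm hcc hdd (pow_orderOf_eq_one _)]

theorem descentChain_orderOf (cs : CoxeterSystem M W) {c d : B} {x : W}
    (hc : cs.IsRightDescent x c) (hd : cs.IsRightDescent x d) :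
    orderOf (cs.simple c * cs.simple d) ≠ 0 ∧
      DescentChain cs c d (orderOf (cs.simple c * cs.simple d)) x := by
  obtain ⟨h0, y, hy, rfl⟩ := exists_eq_mul_altProd cs hc hd
  exact ⟨h0, hy.descentChain (.inr le_rfl)⟩

theorem length_altProd (cs : CoxeterSystem M W) (c d : B) {n : ℕ}
    (hn : orderOf (cs.simple c * cs.simple d) = 0 ∨ n ≤ orderOf (cs.simple c * cs.simple d)) :
    cs.length (altProd (cs.simple c) (cs.simple d) n) = n := by
  have hy : IsResidueMin cs c d 1 := fun t _ ↦ reflCocycle_one cs t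
  refine le_antisymm ?_ (by simpa using (hy.descentChain hn).le_length)
  clear hn hy
  induction n generalizing c d with
  | zero => simp [altProd]
  | succ n ih =>
    have := cs.length_mul_le (altProd (cs.simple d) (cs.simple c) n) (cs.simple c)
    rw [length_simple] at this
    rw [altProd]
    have := ih d c
    omega

section DescentPairs

variable (cs : CoxeterSystem M W) {c d : B} {x : W}

theorem descentChain_of_forall_ne (hc : cs.IsRightDescent x c) (hd : cs.IsRightDescent x d)
    (hne : cs.simple c ≠ cs.simple d) {n : ℕ}
    (hn : ∀ k, 2 ≤ k → k < n → orderOf (cs.simple c * cs.simple d) ≠ k) :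
    DescentChain cs c d n x := by
  obtain ⟨h0, hch⟩ := descentChain_orderOf cs hc hd
  have h1 : orderOf (cs.simple c * cs.simple d) ≠ 1 := by
    rw [Ne, orderOf_eq_one_iff, mul_eq_one_iff_eq_inv, inv_simple]
    exact hne
  refine hch.mono ?_
  by_contra! hlt
  exact hn _ (by omega) hlt rfl

theorem isRightDescent_mul_simple (hc : cs.IsRightDescent x c) (hd : cs.IsRightDescent x d)
    (hne : cs.simple c ≠ cs.simple d) : cs.IsRightDescent (x * cs.simple c) d :=
  (descentChain_of_forall_ne cs hc hd hne (n := 2) (by omega)).2.1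

theorem isRightDescent_mul_simple_mul_simple (hc : cs.IsRightDescent x c)
    (hd : cs.IsRightDescent x d) (hne : cs.simple c ≠ cs.simple d)
    (h2 : orderOf (cs.simple c * cs.simple d) ≠ 2) :
    cs.IsRightDescent (x * cs.simple c * cs.simple d) c :=
  (descentChain_of_forall_ne cs hc hd hne (n := 3) (by omega)).2.2.1

theorem isRightDescent_mul_simple_mul_simple_mul_simple (hc : cs.IsRightDescent x c)
    (hd : cs.IsRightDescent x d) (hne : cs.simple c ≠ cs.simple d)
    (h2 : orderOf (cs.simple c * cs.simple d) ≠ 2)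
    (h3 : orderOf (cs.simple c * cs.simple d) ≠ 3) :
    cs.IsRightDescent (x * cs.simple c * cs.simple d * cs.simple c) d :=
  (descentChain_of_forall_ne cs hc hd hne (n := 4) (by omega)).2.2.2.1

end DescentPairs

theorem mul_simple_comm_of_orderOf_eq_two (cs : CoxeterSystem M W) {c d : B}
    (h : orderOf (cs.simple c * cs.simple d) = 2) (x : W) :
    x * cs.simple c * cs.simple d = x * cs.simple d * cs.simple c := by
  rw [mul_assoc, mul_assoc, mul_comm_of_orderOf_eq_two (cs.simple_mul_simple_self c)
    (cs.simple_mul_simple_self d) h]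

/-- If `s_c s_d` has order at least `5` and the triangle group on `c, d, r` is not spherical, then
`r` cannot be a descent of an element from which four letters `c, d, c, d` can be stripped:
otherwise a shorter such element would exist. -/
theorem not_descentChain_four (cs : CoxeterSystem M W) {c d r : B}
    (hcr : cs.simple c ≠ cs.simple r) (hdr : cs.simple d ≠ cs.simple r)
    (h5 : 5 ≤ orderOf (cs.simple c * cs.simple d))
    (h22 : ¬ (orderOf (cs.simple c * cs.simple r) = 2 ∧ orderOf (cs.simple d * cs.simple r) = 2))
    (h23 : orderOf (cs.simple c * cs.simple d) = 5 →
      ¬ (orderOf (cs.simple c * cs.simple r) = 2 ∧ orderOf (cs.simple d * cs.simple r) = 3))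
    (h32 : orderOf (cs.simple c * cs.simple d) = 5 →
      ¬ (orderOf (cs.simple c * cs.simple r) = 3 ∧ orderOf (cs.simple d * cs.simple r) = 2))
    {x : W} (hr : cs.IsRightDescent x r) : ¬ DescentChain cs c d 4 x := by
  induction hl : cs.length x using Nat.strong_induction_on generalizing c d x with
  | _ l ih =>
  rintro ⟨hc0, hd1, hc2, hd3, -⟩
  have hocd := orderOf_mul_comm (cs.simple_mul_simple_self c) (cs.simple_mul_simple_self d)
  have hocr := orderOf_mul_comm (cs.simple_mul_simple_self c) (cs.simple_mul_simple_self r)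
  have hodr := orderOf_mul_comm (cs.simple_mul_simple_self d) (cs.simple_mul_simple_self r)
  have ihcd : ∀ y, cs.length y < l → cs.IsRightDescent y r → ¬ DescentChain cs c d 4 y :=
    fun y hy hyr ↦ ih _ hy hcr hdr h5 h22 h23 h32 hyr rfl
  have ihdc : ∀ y, cs.length y < l → cs.IsRightDescent y r → ¬ DescentChain cs d c 4 y := by
    intro y hy hyr
    refine ih _ hy hdr hcr (by rwa [hocd]) (fun h ↦ h22 h.symm) (fun h h' ↦ ?_) (fun h h' ↦ ?_)
      hyr rfl
    · exact h32 (by rwa [hocd] at h) h'.symm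
    · exact h23 (by rwa [hocd] at h) h'.symm
  clear ih
  -- `r` remains a descent along the chain.
  have hr1 := isRightDescent_mul_simple cs hc0 hr hcr
  have hr2 := isRightDescent_mul_simple cs hd1 hr1 hdr
  have hr3 := isRightDescent_mul_simple cs hc2 hr2 hcr
  have hlen : ∀ {y : W} {e : B}, cs.IsRightDescent y e →
      cs.length (y * cs.simple e) + 1 = cs.length y := fun h ↦ cs.isRightDescent_iff.1 h
  have l0 := hlen hc0
  have l1 := hlen hd1
  have l2 := hlen hc2
  by_cases hcr2 : orderOf (cs.simple c * cs.simple r) = 2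
  · have hdr2 : orderOf (cs.simple d * cs.simple r) ≠ 2 := fun h ↦ h22 ⟨hcr2, h⟩
    -- Both `c` and `d` are descents of `x c d r`.
    have hFc := isRightDescent_mul_simple cs hr2 hc2 hcr.symm
    have hFd := isRightDescent_mul_simple_mul_simple cs hd1 hr1 hdr hdr2
    have hF := (descentChain_orderOf cs hFc hFd).2
    have hF' := (descentChain_orderOf cs hFd hFc).2
    rw [hocd] at hF'
    have lF := hlen hr2
    by_cases hdr3 : orderOf (cs.simple d * cs.simple r) = 3
    · have h6 : 6 ≤ orderOf (cs.simple c * cs.simple d) := by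
        by_contra hlt
        exact h23 (by omega) ⟨hcr2, hdr3⟩
      have hF6 := hF.mono h6
      have e := mul_simple_comm_of_orderOf_eq_two cs hcr2 (x * cs.simple c * cs.simple d)
      refine ihcd _ ?_ ?_ hF6.2.2
      · have := hlen hF6.1
        have := hlen hF6.2.1
        omega
      · rw [← e]
        exact isRightDescent_mul_simple_mul_simple cs hr3 hd3 hdr.symm (by rwa [hodr])
    · refine ihcd _ ?_ ?_ (hF'.mono h5).2
      · have := hlen hFd
        omega
      · exact isRightDescent_mul_simple_mul_simple_mul_simple cs hd1 hr1 hdr hdr2 hdr3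
  · by_cases hdr2 : orderOf (cs.simple d * cs.simple r) = 2
    · by_cases hcr3 : orderOf (cs.simple c * cs.simple r) = 3
      · have h6 : 6 ≤ orderOf (cs.simple d * cs.simple c) := by
          rw [hocd]
          by_contra hlt
          exact h32 (by omega) ⟨hcr3, hdr2⟩
        have hFd := isRightDescent_mul_simple cs hr1 hd1 hdr.symm
        have hFc := isRightDescent_mul_simple_mul_simple cs hc0 hr hcr hcr2
        have hF6 := (descentChain_orderOf cs hFd hFc).2.mono h6
        have e := mul_simple_comm_of_orderOf_eq_two cs hdr2 (x * cs.simple c)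
        refine ihdc _ ?_ ?_ hF6.2.2
        · have := hlen hr1
          have := hlen hF6.1
          have := hlen hF6.2.1
          omega
        · rw [← e]
          exact isRightDescent_mul_simple_mul_simple cs hr2 hc2 hcr.symm (by rwa [hocr])
      · have hFd := isRightDescent_mul_simple cs hr3 hd3 hdr.symm
        have hFc := isRightDescent_mul_simple_mul_simple cs hc2 hr2 hcr hcr2
        have hF := (descentChain_orderOf cs hFc hFd).2.mono h5
        refine ihdc _ ?_ ?_ hF.2
        · have := hlen hr3
          have := hlen hFc
          omega
        · exact isRightDescent_mul_simple_mul_simple_mul_simple cs hc2 hr2 hcr hcr2 hcr3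
    · have hFd := isRightDescent_mul_simple cs hr3 hd3 hdr.symm
      have hFc := isRightDescent_mul_simple_mul_simple cs hc2 hr2 hcr hcr2
      have hF := (descentChain_orderOf cs hFd hFc).2
      rw [hocd] at hF
      refine ihcd _ ?_ ?_ (hF.mono h5).2
      · have := hlen hr3
        have := hlen hFd
        omega
      · exact isRightDescent_mul_simple_mul_simple cs hr3 hd3 hdr.symm (by rwa [hodr])

/-! ### Finiteness of the spherical triangle groups `(2, 2, n)` and `(2, 3, 5)` -/

theorem finite_closure_of_cosetReps {G : Type*} [Group G] {S X : Set G} {H : Subgroup G}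
    (hS : ∀ g ∈ S, g * g = 1) (hH : (H : Set G).Finite) (hX : X.Finite) (h1 : 1 ∈ X)
    (hmul : ∀ x ∈ X, ∀ g ∈ S, ∃ h ∈ H, ∃ x' ∈ X, x * g = h * x') :
    Finite (Subgroup.closure S) := by
  have key : ∀ p : G, (∃ h ∈ H, ∃ x ∈ X, p = h * x) → ∀ g ∈ S, ∃ h ∈ H, ∃ x ∈ X, p * g = h * x := by
    rintro _ ⟨h, hh, x, hx, rfl⟩ g hg
    obtain ⟨h', hh', x', hx', e⟩ := hmul x hx g hg
    exact ⟨h * h', mul_mem hh hh', x', hx', by rw [mul_assoc, e, mul_assoc]⟩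
  refine ((hH.image2 (· * ·) hX).subset fun p hp ↦ ?_ :
    (Subgroup.closure S : Set G).Finite)
  suffices ∃ h ∈ H, ∃ x ∈ X, p = h * x by
    obtain ⟨h, hh, x, hx, rfl⟩ := this
    exact ⟨h, hh, x, hx, rfl⟩
  induction hp using Subgroup.closure_induction_right with
  | one => exact ⟨1, one_mem _, 1, h1, by simp⟩
  | mul_right p _ g hg ih => exact key p ih g hg
  | mul_inv_cancel p _ g hg ih =>
    rw [inv_eq_of_mul_eq_one_right (hS g hg)]
    exact key p ih g hg

theorem finite_closure_pair {G : Type*} [Group G] {a b : G} (ha : a * a = 1) (hb : b * b = 1)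
    (hab : orderOf (a * b) ≠ 0) : (Subgroup.closure {a, b} : Set G).Finite := by
  refine (((Set.finite_Iic (orderOf (a * b))).image (altProd a b)).union
    ((Set.finite_Iic (orderOf (a * b))).image (altProd b a))).subset fun u hu ↦ ?_
  obtain ⟨n, hn, h⟩ := exists_eq_altProd_of_mem_closure ha hb hu
  have hn' : n ∈ Set.Iic (orderOf (a * b)) := Set.mem_Iic.2 (by omega)
  exact h.imp (fun h ↦ ⟨n, hn', h.symm⟩) (fun h ↦ ⟨n, hn', h.symm⟩)

theorem finite_closure_of_orderOf_eq_two_two {G : Type*} [Group G] {a b r : G} (ha : a * a = 1)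
    (hb : b * b = 1) (hr : r * r = 1) (hab : orderOf (a * b) ≠ 0) (har : orderOf (a * r) = 2)
    (hbr : orderOf (b * r) = 2) : Finite (Subgroup.closure {a, b, r}) := by
  have har := mul_comm_of_orderOf_eq_two ha hr har
  have hbr := mul_comm_of_orderOf_eq_two hb hr hbr
  have hamem : a ∈ Subgroup.closure {a, b} := Subgroup.subset_closure (by simp)
  have hbmem : b ∈ Subgroup.closure {a, b} := Subgroup.subset_closure (by simp)
  refine finite_closure_of_cosetReps (X := {1, r}) (by simp [ha, hb, hr])
    (finite_closure_pair ha hb hab) (by simp) (by simp) ?_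
  rintro x (rfl | rfl) g (rfl | rfl | rfl)
  · exact ⟨_, hamem, 1, by simp, by simp⟩
  · exact ⟨_, hbmem, 1, by simp, by simp⟩
  · exact ⟨1, one_mem _, g, by simp, by simp⟩
  · exact ⟨_, hamem, x, by simp, har.symm⟩
  · exact ⟨_, hbmem, x, by simp, hbr.symm⟩
  · exact ⟨1, one_mem _, 1, by simp, by simp [hr]⟩

/-- The icosahedral relations define a finite group: the listed `12` elements represent all cosets
of the dihedral subgroup of order `10`. -/
theorem finite_closure_of_orderOf_eq_two_three_five {G : Type*} [Group G] {a b r : G}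
    (ha : a * a = 1) (hb : b * b = 1) (hr : r * r = 1) (hab : orderOf (a * b) = 5)
    (har : orderOf (a * r) = 2) (hbr : orderOf (b * r) = 3) :
    Finite (Subgroup.closure {a, b, r}) := by
  have cancel : ∀ {g : G}, g * g = 1 → ∀ {x y : G}, y = x * g → y * g = x := by
    rintro g hg x _ rfl
    rw [mul_assoc, hg, mul_one]
  have comm : ∀ z : G, z * r * a = z * a * r := fun z ↦ by
    rw [mul_assoc, ← mul_comm_of_orderOf_eq_two ha hr har, mul_assoc]
  have braid3 : ∀ z : G, z * b * r * b = z * r * b * r := fun z ↦ by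
    have := altProd_comm hb hr (hbr ▸ pow_orderOf_eq_one _)
    simp only [altProd, one_mul] at this
    simpa only [mul_assoc] using congrArg (z * ·) this
  have braid5 : ∀ z : G, z * a * b * a * b * a = z * b * a * b * a * b := fun z ↦ by
    have := altProd_comm ha hb (hab ▸ pow_orderOf_eq_one _)
    simp only [altProd, one_mul] at this
    simpa only [mul_assoc] using congrArg (z * ·) this
  obtain ⟨x₂, h₂⟩ : ∃ x, x = r * b := ⟨_, rfl⟩
  obtain ⟨x₃, h₃⟩ : ∃ x, x = x₂ * a := ⟨_, rfl⟩
  obtain ⟨x₄, h₄⟩ : ∃ x, x = x₃ * b := ⟨_, rfl⟩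
  obtain ⟨x₅, h₅⟩ : ∃ x, x = x₄ * a := ⟨_, rfl⟩
  obtain ⟨y₅, k₅⟩ : ∃ x, x = x₄ * r := ⟨_, rfl⟩
  obtain ⟨x₆, h₆⟩ : ∃ x, x = x₅ * r := ⟨_, rfl⟩
  obtain ⟨x₇, h₇⟩ : ∃ x, x = x₆ * b := ⟨_, rfl⟩
  obtain ⟨x₈, h₈⟩ : ∃ x, x = x₇ * a := ⟨_, rfl⟩
  obtain ⟨x₉, h₉⟩ : ∃ x, x = x₈ * b := ⟨_, rfl⟩
  obtain ⟨x₁₀, h₁₀⟩ : ∃ x, x = x₉ * r := ⟨_, rfl⟩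
  have k₆ : x₆ = y₅ * a := by rw [h₆, h₅, k₅, comm]
  have f₁ : r * a = a * r := by simpa using comm 1
  have f₂ : x₂ * r = b * x₂ := by simpa [h₂, mul_assoc] using (braid3 1).symm
  have f₃ : x₃ * r = b * x₃ := by rw [h₃, ← comm, f₂, mul_assoc]
  have f₅ : x₅ * b = a * x₅ := by
    rw [h₅, h₄, h₃, h₂, ← braid5, f₁]
    simp only [mul_assoc]
  have g₅ : y₅ * b = b * y₅ := by
    rw [k₅, h₄, braid3, f₃]
    simp only [mul_assoc]
  have f₇ : x₇ * r = a * x₇ := by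
    rw [h₇, h₆, ← braid3, f₅]
    simp only [mul_assoc]
  have f₈ : x₈ * r = a * x₈ := by rw [h₈, ← comm, f₇, mul_assoc]
  have f₉ : x₉ * a = b * x₉ := by
    rw [h₉, h₈, h₇, k₆, braid5, g₅]
    simp only [mul_assoc]
  have f₁₀ : x₁₀ * a = b * x₁₀ := by rw [h₁₀, comm, f₉, mul_assoc]
  have g₁₀ : x₁₀ * b = a * x₁₀ := by
    rw [h₁₀, h₉, braid3, f₈]
    simp only [mul_assoc]
  set X : Set G := {1, r, x₂, x₃, x₄, x₅, y₅, x₆, x₇, x₈, x₉, x₁₀} with hX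
  have move : ∀ {x g y : G}, x * g = y → y ∈ X → x * g = a * x ∨ x * g = b * x ∨ x * g ∈ X :=
    fun e hy ↦ .inr (.inr (e ▸ hy))
  have main : ∀ x ∈ X, ∀ g, g = a ∨ g = b ∨ g = r →
      x * g = a * x ∨ x * g = b * x ∨ x * g ∈ X := by
    rintro x (rfl | rfl | rfl | rfl | rfl | rfl | rfl | rfl | rfl | rfl | rfl | rfl) g
      (rfl | rfl | rfl)
    · exact .inl (by simp)
    · exact .inr (.inl (by simp))
    · exact move (one_mul _) (by simp [hX])
    · exact .inl f₁
    · exact move h₂.symm (by simp [hX])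
    · exact move hr (by simp [hX])
    · exact move h₃.symm (by simp [hX])
    · exact move (cancel hb h₂) (by simp [hX])
    · exact .inr (.inl f₂)
    · exact move (cancel ha h₃) (by simp [hX])
    · exact move h₄.symm (by simp [hX])
    · exact .inr (.inl f₃)
    · exact move h₅.symm (by simp [hX])
    · exact move (cancel hb h₄) (by simp [hX])
    · exact move k₅.symm (by simp [hX])
    · exact move (cancel ha h₅) (by simp [hX])
    · exact .inl f₅
    · exact move h₆.symm (by simp [hX])
    · exact move k₆.symm (by simp [hX])
    · exact .inr (.inl g₅)
    · exact move (cancel hr k₅) (by simp [hX])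
    · exact move (cancel ha k₆) (by simp [hX])
    · exact move h₇.symm (by simp [hX])
    · exact move (cancel hr h₆) (by simp [hX])
    · exact move h₈.symm (by simp [hX])
    · exact move (cancel hb h₇) (by simp [hX])
    · exact .inl f₇
    · exact move (cancel ha h₈) (by simp [hX])
    · exact move h₉.symm (by simp [hX])
    · exact .inl f₈
    · exact .inr (.inl f₉)
    · exact move (cancel hb h₉) (by simp [hX])
    · exact move h₁₀.symm (by simp [hX])
    · exact .inr (.inl f₁₀)
    · exact .inl g₁₀
    · exact move (cancel hr h₁₀) (by simp [hX])
  refine finite_closure_of_cosetReps (X := X) (by simp [ha, hb, hr])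
    (finite_closure_pair ha hb (by omega)) (by simp [hX]) (by simp [hX]) fun x hx g hg ↦ ?_
  rcases main x hx g hg with h | h | h
  · exact ⟨a, Subgroup.subset_closure (by simp), x, hx, h⟩
  · exact ⟨b, Subgroup.subset_closure (by simp), x, hx, h⟩
  · exact ⟨1, one_mem _, _, h, (one_mul _).symm⟩

/-- The longest element of a finite dihedral parabolic subgroup. -/
theorem eq_altProd_of_forall_length_le (cs : CoxeterSystem M W) {c d : B}
    (h0 : orderOf (cs.simple c * cs.simple d) ≠ 0) {w : W}
    (hw : w ∈ Subgroup.closure {cs.simple c, cs.simple d})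
    (hle : orderOf (cs.simple c * cs.simple d) ≤ cs.length w) :
    w = altProd (cs.simple c) (cs.simple d) (orderOf (cs.simple c * cs.simple d)) := by
  have hc := cs.simple_mul_simple_self c
  have hd := cs.simple_mul_simple_self d
  obtain ⟨n, hn, h⟩ := exists_eq_altProd_of_mem_closure hc hd hw
  have hnw : cs.length w = n := by
    rcases h with h | h
    · rw [h, length_altProd cs c d hn]
    · rw [h, length_altProd cs d c (by rwa [orderOf_mul_comm hc hd])]
  obtain rfl : n = orderOf (cs.simple c * cs.simple d) := by omega
  rcases h with h | h
  · exact h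
  · rw [h, altProd_comm hc hd (pow_orderOf_eq_one _)]

theorem wg_eq_altProd (cs : CoxeterSystem M W) {f : W} {c d : B}
    (hT : descentSet cs f = {c, d}) (h0 : orderOf (cs.simple c * cs.simple d) ≠ 0) :
    wg cs f = altProd (cs.simple c) (cs.simple d) (orderOf (cs.simple c * cs.simple d)) := by
  have hH : descSubgroup cs f = Subgroup.closure {cs.simple c, cs.simple d} := by
    rw [descSubgroup, hT, Set.image_pair]
  have hlen := length_altProd cs c d (.inr le_rfl)
  have hmem := altProd_mem_closure (cs.simple c) (cs.simple d)
    (orderOf (cs.simple c * cs.simple d))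
  have hex : ∃ w₀ ∈ descSubgroup cs f, ∀ u ∈ descSubgroup cs f, cs.length u ≤ cs.length w₀ := by
    rw [hH]
    refine ⟨_, hmem, fun u hu ↦ ?_⟩
    rw [hlen]
    by_contra! hlt
    rw [eq_altProd_of_forall_length_le cs h0 hu hlt.le, hlen] at hlt
    exact lt_irrefl _ hlt
  rw [wg, dif_pos hex]
  obtain ⟨hw, hmax⟩ := hex.choose_spec
  exact eq_altProd_of_forall_length_le cs h0 (hH.le hw) (hlen ▸ hmax _ (hH.ge hmem))

/-- Multiplying by the longest element of `⟨T(f)⟩` yields the minimal element of the residue. -/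
theorem isResidueMin_PiMap (cs : CoxeterSystem M W) {f : W} {c d : B}
    (hT : descentSet cs f = {c, d}) : IsResidueMin cs c d (PiMap cs f) := by
  have hfc : cs.IsRightDescent f c := hT.symm.subset (by simp : c ∈ ({c, d} : Set B))
  have hfd : cs.IsRightDescent f d := hT.symm.subset (by simp : d ∈ ({c, d} : Set B))
  obtain ⟨h0, y, hy, hf⟩ := exists_eq_mul_altProd cs hfc hfd
  set P := altProd (cs.simple c) (cs.simple d) (orderOf (cs.simple c * cs.simple d)) with hP
  have hPinv : P⁻¹ = P := by
    refine eq_altProd_of_forall_length_le cs h0 (inv_mem (altProd_mem_closure _ _ _)) ?_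
    rw [length_inv, length_altProd cs c d (.inr le_rfl)]
  have hPi : PiMap cs f = y := by
    rw [PiMap, wg_eq_altProd cs hT h0, ← hP]
    rw [← hPinv, hf, mul_inv_cancel_right]
  rwa [hPi]

/-- **Corollary (i).** With `h = Π(f)` and `m` the distance between `g` and `h`, one has
`m ≤ 3`. -/
theorem corollary_step1_i
    (cs : CoxeterSystem M W) (h2 : TwoDimensional cs)
    (f : W) (i j : B) (hij : i ≠ j) (hTf : descentSet cs f = {i, j})
    (g : W) (hgR : f⁻¹ * g ∈ Subgroup.closure {cs.simple i, cs.simple j})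
    (k : B) (hki : k ≠ i) (hkj : k ≠ j) (hTg : descentSet cs g = {i, k}) :
    cs.length ((PiMap cs f)⁻¹ * g) ≤ 3 := by
  have hi := cs.simple_mul_simple_self i
  have hj := cs.simple_mul_simple_self j
  have hk := cs.simple_mul_simple_self k
  have hfi : cs.IsRightDescent f i := hTf.symm.subset (by simp : i ∈ ({i, j} : Set B))
  have hfj : cs.IsRightDescent f j := hTf.symm.subset (by simp : j ∈ ({i, j} : Set B))
  have hfk : ¬ cs.IsRightDescent f k := fun h ↦ by
    have : k ∈ ({i, j} : Set B) := hTf.subset h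
    simp [hki, hkj] at this
  have hgi : cs.IsRightDescent g i := hTg.symm.subset (by simp : i ∈ ({i, k} : Set B))
  have hgk : cs.IsRightDescent g k := hTg.symm.subset (by simp : k ∈ ({i, k} : Set B))
  have hgj : ¬ cs.IsRightDescent g j := fun h ↦ by
    have : j ∈ ({i, k} : Set B) := hTg.subset h
    simp [hij.symm, hkj.symm] at this
  have hik : cs.simple i ≠ cs.simple k := fun h ↦ hfk (by rwa [IsRightDescent, ← h])
  have hjk : cs.simple j ≠ cs.simple k := fun h ↦ hfk (by rwa [IsRightDescent, ← h])
  have h0 := (exists_eq_mul_altProd cs hfi hfj).1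
  have hy := isResidueMin_PiMap cs hTf
  have hv : (PiMap cs f)⁻¹ * g ∈ Subgroup.closure {cs.simple i, cs.simple j} := by
    rw [PiMap, mul_inv_rev, mul_assoc, wg_eq_altProd cs hTf h0]
    exact mul_mem (inv_mem (altProd_mem_closure _ _ _)) hgR
  set y := PiMap cs f
  have hg : g = y * (y⁻¹ * g) := (mul_inv_cancel_left y g).symm
  obtain ⟨n, hn, hvn⟩ := exists_eq_altProd_of_mem_closure hi hj hv
  by_contra! hlt
  -- The normal form of `y⁻¹ * g` ends in `s_i`, since `j` is not a descent of `g`.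
  have hvi : y⁻¹ * g = altProd (cs.simple i) (cs.simple j) n := by
    refine hvn.resolve_right fun h ↦ hgj ?_
    have hn0 : n ≠ 0 := by
      rintro rfl
      rw [h] at hlt
      simp [altProd] at hlt
    rw [hg, hy.isRightDescent_iff hv (.inr rfl), h]
    exact reflCocycle_altProd_last cs j i hn0 (by rwa [orderOf_mul_comm hi hj])
  have hlen : 4 ≤ n := by rwa [hvi, length_altProd cs i j hn] at hlt
  have hne : n ≠ orderOf (cs.simple i * cs.simple j) := by
    intro h
    refine hgj ?_
    rw [hg, hy.isRightDescent_iff hv (.inr rfl), hvi, h,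
      altProd_comm hi hj (pow_orderOf_eq_one _)]
    exact reflCocycle_altProd_last cs j i h0 (by rw [orderOf_mul_comm hi hj]; exact .inr le_rfl)
  have hinf := h2 i j k hij hki.symm hkj.symm
  have hinf' : Infinite (Subgroup.closure {cs.simple j, cs.simple i, cs.simple k}) := by
    rwa [Set.insert_comm]
  refine not_descentChain_four cs (c := i) (d := j) hik hjk (by omega) ?_ ?_ ?_ hgk ?_
  · rintro ⟨h, h'⟩
    exact hinf.not_finite (finite_closure_of_orderOf_eq_two_two hi hj hk h0 h h')
  · rintro h5 ⟨h, h'⟩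
    exact hinf.not_finite (finite_closure_of_orderOf_eq_two_three_five hi hj hk h5 h h')
  · rintro h5 ⟨h, h'⟩
    exact hinf'.not_finite (finite_closure_of_orderOf_eq_two_three_five hj hi hk
      (by rwa [orderOf_mul_comm hi hj]) h' h)
  · have := hy.descentChain hn
    rw [← hvi, ← hg] at this
    exact this.mono hlen

end CoxeterPaper
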